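/- Let k be a field of characteristic different from 2 and let (A,B,C) be a triple with A = {α_1,α_2,α_3,α_4}, B = {(β_1^0,β_1^1),…,(β_m^0,β_m^1)}, C = {γ_1,…,γ_{p−m−2}}, indices drawn from {1,…,n}. Then the quadratic form P'_{A,B,C} on ⋀^p k^n has rank at most 6; and if all the indices α_i, β_j^(μ), γ_l are pairwise distinct, its rank is exactly 6. (Rank means the rank of the symmetric bilinear form Q(ω,η) = P'(ω+η) − P'(ω) − P'(η) as a linear map ⋀^p k^n → (⋀^p k^n)^*.) -/

import Mathlib

open ExteriorAlgebra

noncomputable section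

variable (k : Type*) [Field k]

/-- The alternating map giving the coordinate `Π_idx` (antisymmetric in `idx`). -/
def coordA {n : ℕ} (q : ℕ) (idx : Fin q → Fin n) :
    (Fin n → k) [⋀^Fin q]→ₗ[k] k :=
  (Matrix.detRowAlternating : (Fin q → k) [⋀^Fin q]→ₗ[k] k).compLinearMap
    (LinearMap.funLeft k k idx)

/-- The coordinate functional `Π_idx` on the exterior algebra. -/
def coordF {n : ℕ} (q : ℕ) (idx : Fin q → Fin n) :
    ExteriorAlgebra k (Fin n → k) →ₗ[k] k :=
  ExteriorAlgebra.liftAlternating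
    (Function.update (fun i => (0 : (Fin n → k) [⋀^Fin i]→ₗ[k] k)) q (coordA k q idx))

/-- Decomposability of an element of the exterior algebra, in degree `q`. -/
def IsDecomp {n : ℕ} (q : ℕ) (x : ExteriorAlgebra k (Fin n → k)) : Prop :=
  ∃ v : Fin q → (Fin n → k), x = ExteriorAlgebra.ιMulti k q v

/-- The dual isomorphism `δ` on the degree-`p` part, with values in degree `n-p`. -/
def dualAt (n p : ℕ) (ω : ExteriorAlgebra k (Fin n → k)) :
    ExteriorAlgebra k (Fin n → k) :=
  ∑ s : {s : Finset (Fin n) // s.card = p},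
    coordF k p (fun a => (s.1.orderIsoOfFin s.2 a : Fin n)) ω •
      ExteriorAlgebra.ιMulti k (n - p)
        (fun a => Pi.single (((s.1ᶜ).orderIsoOfFin
          (by rw [Finset.card_compl, s.2, Fintype.card_fin]) a : Fin n)) (1 : k))

/-- The index tuple `(α_i, α_j, β_1^{ε_1}, …, β_m^{ε_m}, γ_1, …, γ_c)`. -/
def tupleP {n : ℕ} (m c : ℕ) (α : Fin 4 → Fin n) (β : Fin m → Fin 2 → Fin n)
    (γ : Fin c → Fin n) (i j : Fin 4) (ε : Fin m → Fin 2) : Fin (2 + (m + c)) → Fin n :=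
  Fin.append ![α i, α j] (Fin.append (fun l => β l (ε l)) γ)

/-- The functional `π_{ij} = Π_{α_i α_j β⃗_1 … β⃗_m γ_1 … γ_c}`. -/
def piF {n : ℕ} (m c : ℕ) (α : Fin 4 → Fin n) (β : Fin m → Fin 2 → Fin n)
    (γ : Fin c → Fin n) (i j : Fin 4) :
    ExteriorAlgebra k (Fin n → k) →ₗ[k] k :=
  ∑ ε : Fin m → Fin 2, coordF k (2 + (m + c)) (tupleP m c α β γ i j ε)

/-- The rank 6 quadratic form `P'_{A,B,C}`. -/
def Pprime {n : ℕ} (m c : ℕ) (α : Fin 4 → Fin n) (β : Fin m → Fin 2 → Fin n)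
    (γ : Fin c → Fin n) (ω : ExteriorAlgebra k (Fin n → k)) : k :=
  piF k m c α β γ 0 1 ω * piF k m c α β γ 2 3 ω
    - piF k m c α β γ 0 2 ω * piF k m c α β γ 1 3 ω
    + piF k m c α β γ 0 3 ω * piF k m c α β γ 1 2 ω

/-- The ordering/distinctness conditions on the triple `(A,B,C)`. -/
def OrderedABC {n : ℕ} (m c : ℕ) (α : Fin 4 → Fin n) (β : Fin m → Fin 2 → Fin n)
    (γ : Fin c → Fin n) : Prop :=
  Function.Injective (Sum.elim α (Sum.elim (fun x : Fin m × Fin 2 => β x.1 x.2) γ)) ∧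
    StrictMono α ∧ (∀ l, β l 0 < β l 1) ∧
    (∀ ν : Fin 2, StrictMono fun l => β l ν) ∧
    (∀ l, β l 0 < α 0) ∧ (∀ l, β l 1 < α 2) ∧ StrictMono γ

/-- The set `S' = A ∪ B_1 ∪ C`. -/
def SP {n : ℕ} (m c : ℕ) (α : Fin 4 → Fin n) (β : Fin m → Fin 2 → Fin n)
    (γ : Fin c → Fin n) : Finset (Fin n) :=
  Finset.univ.image α ∪ Finset.univ.image (fun l => β l 1) ∪ Finset.univ.image γ

open Classical in
/-- The matrix of the map `X_{A,B,C} : k^n → k^{p+2}`. -/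
def Xmat (p : ℕ) {n : ℕ} (m c : ℕ) (α : Fin 4 → Fin n) (β : Fin m → Fin 2 → Fin n)
    (γ : Fin c → Fin n) : Matrix (Fin (p + 2)) (Fin n) k :=
  if h : (SP m c α β γ).card = p + 2 then
    fun j i =>
      (if i = ((SP m c α β γ).orderIsoOfFin h j : Fin n) then 1 else 0) +
        ∑ l : Fin m,
          if i = β l 0 ∧ β l 1 = ((SP m c α β γ).orderIsoOfFin h j : Fin n) then 1 else 0
  else 0

/-- The linear map `X_{A,B,C} : k^n → k^{p+2}`. -/
def XL (p : ℕ) {n : ℕ} (m c : ℕ) (α : Fin 4 → Fin n) (β : Fin m → Fin 2 → Fin n)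
    (γ : Fin c → Fin n) : (Fin n → k) →ₗ[k] (Fin (p + 2) → k) :=
  (Xmat k p m c α β γ).mulVecLin

open Classical in
/-- The matrix of the map `Z : k^{p+2} → k^4`. -/
def Zmat (p : ℕ) {n : ℕ} (m c : ℕ) (α : Fin 4 → Fin n) (β : Fin m → Fin 2 → Fin n)
    (γ : Fin c → Fin n) : Matrix (Fin 4) (Fin (p + 2)) k :=
  fun j i => if XL k p m c α β γ (Pi.single (α j) 1) = Pi.single i 1 then 1 else 0

/-- The linear map `Z : k^{p+2} → k^4`. -/
def ZL (p : ℕ) {n : ℕ} (m c : ℕ) (α : Fin 4 → Fin n) (β : Fin m → Fin 2 → Fin n)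
    (γ : Fin c → Fin n) : (Fin (p + 2) → k) →ₗ[k] (Fin 4 → k) :=
  (Zmat k p m c α β γ).mulVecLin

/-- The Grassmann cone preserving map `G_{A,B,C} = ⋀²Z ∘ δ ∘ ⋀^p X_{A,B,C}`. -/
def GABC (p : ℕ) {n : ℕ} (m c : ℕ) (α : Fin 4 → Fin n) (β : Fin m → Fin 2 → Fin n)
    (γ : Fin c → Fin n) (ω : ExteriorAlgebra k (Fin n → k)) :
    ExteriorAlgebra k (Fin 4 → k) :=
  ExteriorAlgebra.map (ZL k p m c α β γ)
    (dualAt k (p + 2) p (ExteriorAlgebra.map (XL k p m c α β γ) ω))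

/-- The general Plücker quadratic form `P_{A,B}` for index sequences
`a : Fin d → Fin n` and `b : Fin (e+1) → Fin n`. -/
def Pluecker {n : ℕ} (d e : ℕ) (a : Fin d → Fin n) (b : Fin (e + 1) → Fin n)
    (ω : ExteriorAlgebra k (Fin n → k)) : k :=
  ∑ i : Fin (e + 1), (-1 : k) ^ (i : ℕ) *
    (coordF k (d + 1) (Fin.snoc a (b i)) ω * coordF k e (fun j => b (i.succAbove j)) ω)


/-- The polarization `Q(ω,η) = P'(ω+η) − P'(ω) − P'(η)` of the quadratic form
`P'_{A,B,C}`, as a linear map into the dual space. -/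
def pprimeBil (k : Type*) [Field k] {n : ℕ} (m c : ℕ)
    (α : Fin 4 → Fin n) (β : Fin m → Fin 2 → Fin n) (γ : Fin c → Fin n) :
    (⋀[k]^(2 + (m + c)) (Fin n → k)) →ₗ[k]
      ((⋀[k]^(2 + (m + c)) (Fin n → k)) →ₗ[k] k) :=
  let π : Fin 4 → Fin 4 → ((⋀[k]^(2 + (m + c)) (Fin n → k)) →ₗ[k] k) := fun i j =>
    (piF k m c α β γ i j).comp (Submodule.subtype _)
  (π 0 1).smulRight (π 2 3) + (π 2 3).smulRight (π 0 1)
    - (π 0 2).smulRight (π 1 3) - (π 1 3).smulRight (π 0 2)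
    + (π 0 3).smulRight (π 1 2) + (π 1 2).smulRight (π 0 3)

/-- The standard basis `p`-vector `e_{u_0} ∧ ⋯ ∧ e_{u_{q-1}}`, as an element of the exterior power. -/
def basisVec {n : ℕ} (q : ℕ) (u : Fin q → Fin n) : ⋀[k]^q (Fin n → k) :=
  exteriorPower.ιMulti k q fun r => Pi.single (u r) (1 : k)

theorem coordF_basisVec {n : ℕ} (q : ℕ) (idx u : Fin q → Fin n) :
    coordF k q idx (basisVec k q u : ExteriorAlgebra k (Fin n → k)) =
      (Matrix.of fun r s => (Pi.single (u r) (1 : k) : Fin n → k) (idx s)).det := by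
  rw [basisVec, exteriorPower.ιMulti_apply_coe, coordF,
    ExteriorAlgebra.liftAlternating_apply_ιMulti, Function.update_self]
  rfl

theorem coordF_basisVec_self {n : ℕ} (q : ℕ) (u : Fin q → Fin n) (hu : Function.Injective u) :
    coordF k q u (basisVec k q u : ExteriorAlgebra k (Fin n → k)) = 1 := by
  rw [coordF_basisVec]
  convert Matrix.det_one (n := Fin q) (R := k) using 2
  ext r s
  simp [Pi.single_apply, Matrix.one_apply, hu.eq_iff, eq_comm]

theorem coordF_basisVec_eq_zero {n : ℕ} (q : ℕ) (idx u : Fin q → Fin n) (r : Fin q)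
    (hr : ∀ s, idx s ≠ u r) :
    coordF k q idx (basisVec k q u : ExteriorAlgebra k (Fin n → k)) = 0 := by
  rw [coordF_basisVec]
  exact Matrix.det_eq_zero_of_row_eq_zero r fun s => by simp [Pi.single_apply, hr s]

section Tuples

variable {n m c : ℕ} {α : Fin 4 → Fin n} {β : Fin m → Fin 2 → Fin n} {γ : Fin c → Fin n}

/-- The labels of the entries of `tupleP`. -/
def tupleLabel (m c : ℕ) (i j : Fin 4) (ε : Fin m → Fin 2) :
    Fin (2 + (m + c)) → Fin 4 ⊕ (Fin m × Fin 2) ⊕ Fin c :=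
  Fin.append ![Sum.inl i, Sum.inl j]
    (Fin.append (fun l => Sum.inr (Sum.inl (l, ε l))) fun l => Sum.inr (Sum.inr l))

theorem tupleP_eq_comp (i j : Fin 4) (ε : Fin m → Fin 2) :
    tupleP m c α β γ i j ε =
      Sum.elim α (Sum.elim (fun x : Fin m × Fin 2 => β x.1 x.2) γ) ∘ tupleLabel m c i j ε := by
  funext s
  induction s using Fin.addCases with
  | left s => fin_cases s <;> simp [tupleP, tupleLabel, Fin.append_left]
  | right s =>
    induction s using Fin.addCases with
    | left s => simp [tupleP, tupleLabel]
    | right s => simp [tupleP, tupleLabel]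

theorem tupleLabel_eq_inl {i j a : Fin 4} {ε : Fin m → Fin 2} {s : Fin (2 + (m + c))}
    (h : tupleLabel m c i j ε s = Sum.inl a) : a = i ∨ a = j := by
  induction s using Fin.addCases with
  | left s => fin_cases s <;> simp_all [tupleLabel]
  | right s =>
    induction s using Fin.addCases with
    | left s => simp [tupleLabel] at h
    | right s => simp [tupleLabel] at h

theorem tupleLabel_eq_inr_inl {i j : Fin 4} {ε : Fin m → Fin 2} {s : Fin (2 + (m + c))}
    {x : Fin m × Fin 2} (h : tupleLabel m c i j ε s = Sum.inr (Sum.inl x)) : ε x.1 = x.2 := by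
  induction s using Fin.addCases with
  | left s => fin_cases s <;> simp [tupleLabel] at h
  | right s =>
    induction s using Fin.addCases with
    | left s =>
      simp only [tupleLabel, Fin.append_right, Fin.append_left, Sum.inr.injEq,
        Sum.inl.injEq] at h
      simp [← h]
    | right s => simp [tupleLabel] at h

theorem tupleLabel_injective {i j : Fin 4} (hij : i ≠ j) (ε : Fin m → Fin 2) :
    Function.Injective (tupleLabel m c i j ε) := by
  rw [tupleLabel, Fin.append_injective_iff, Fin.append_injective_iff]
  refine ⟨?_, ⟨?_, ?_, ?_⟩, ?_⟩
  · intro s t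
    fin_cases s <;> fin_cases t <;> simp [hij, hij.symm]
  · intro s t h
    simpa using (congrArg Prod.fst (Sum.inl_injective (Sum.inr_injective h)))
  · exact Sum.inr_injective.comp Sum.inr_injective
  · simp
  · intro s t
    induction t using Fin.addCases <;> fin_cases s <;> simp

theorem piF_basisVec_self
    (hE : Function.Injective (Sum.elim α (Sum.elim (fun x : Fin m × Fin 2 => β x.1 x.2) γ)))
    {i j : Fin 4} (hij : i ≠ j) :
    piF k m c α β γ i j
      (basisVec k _ (tupleP m c α β γ i j 0) : ExteriorAlgebra k (Fin n → k)) = 1 := by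
  rw [piF, LinearMap.sum_apply, Finset.sum_eq_single 0]
  · refine coordF_basisVec_self k _ _ ?_
    rw [tupleP_eq_comp]
    exact hE.comp (tupleLabel_injective hij 0)
  · intro ε _ hε
    obtain ⟨l, hl⟩ := Function.ne_iff.mp hε
    refine coordF_basisVec_eq_zero k _ _ _ (Fin.natAdd 2 (Fin.castAdd c l)) fun s hs => hl ?_
    rw [tupleP_eq_comp, tupleP_eq_comp] at hs
    have h := hE hs
    rw [show tupleLabel m c i j 0 (Fin.natAdd 2 (Fin.castAdd c l)) =
      Sum.inr (Sum.inl (l, 0)) by simp [tupleLabel]] at h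
    exact tupleLabel_eq_inr_inl h
  · simp

theorem piF_basisVec_eq_zero
    (hE : Function.Injective (Sum.elim α (Sum.elim (fun x : Fin m × Fin 2 => β x.1 x.2) γ)))
    {i j a b : Fin 4} (h : ¬ ((a = i ∨ a = j) ∧ (b = i ∨ b = j))) :
    piF k m c α β γ i j
      (basisVec k _ (tupleP m c α β γ a b 0) : ExteriorAlgebra k (Fin n → k)) = 0 := by
  rw [piF, LinearMap.sum_apply]
  refine Finset.sum_eq_zero fun ε _ => ?_
  rw [tupleP_eq_comp, tupleP_eq_comp]
  rcases not_and_or.mp h with h | h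
  · refine coordF_basisVec_eq_zero k _ _ _ (Fin.castAdd _ 0) fun s hs => h ?_
    exact tupleLabel_eq_inl ((hE hs).trans (by simp [tupleLabel, Fin.append_left]))
  · refine coordF_basisVec_eq_zero k _ _ _ (Fin.castAdd _ 1) fun s hs => h ?_
    exact tupleLabel_eq_inl ((hE hs).trans (by simp [tupleLabel, Fin.append_left]))

end Tuples

/-- The restriction of `π_{ij}` to the exterior power. -/
def piRes {n : ℕ} (m c : ℕ) (α : Fin 4 → Fin n) (β : Fin m → Fin 2 → Fin n)
    (γ : Fin c → Fin n) (i j : Fin 4) : (⋀[k]^(2 + (m + c)) (Fin n → k)) →ₗ[k] k :=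
  (piF k m c α β γ i j).comp (Submodule.subtype _)

/-- The six functionals `π_{ij}` with `i < j`, ordered so that `P'` pairs the `s`-th one with the
`(5 - s)`-th one. -/
def piFamily {n : ℕ} (m c : ℕ) (α : Fin 4 → Fin n) (β : Fin m → Fin 2 → Fin n)
    (γ : Fin c → Fin n) (s : Fin 6) : (⋀[k]^(2 + (m + c)) (Fin n → k)) →ₗ[k] k :=
  piRes k m c α β γ (![0, 0, 0, 1, 1, 2] s) (![1, 2, 3, 2, 3, 3] s)

theorem pprimeBil_apply {n : ℕ} (m c : ℕ) (α : Fin 4 → Fin n) (β : Fin m → Fin 2 → Fin n)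
    (γ : Fin c → Fin n) (ω : ⋀[k]^(2 + (m + c)) (Fin n → k)) :
    pprimeBil k m c α β γ ω =
      ∑ s : Fin 6, (![1, -1, 1, 1, -1, 1] s * piFamily k m c α β γ s ω) •
        piFamily k m c α β γ s.rev := by
  refine LinearMap.ext fun η => ?_
  simp only [Fin.sum_univ_six]
  change _ = (((1 : k) * piRes k m c α β γ 0 1 ω) • piRes k m c α β γ 2 3 +
    (-1 * piRes k m c α β γ 0 2 ω) • piRes k m c α β γ 1 3 +
    (1 * piRes k m c α β γ 0 3 ω) • piRes k m c α β γ 1 2 +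
    (1 * piRes k m c α β γ 1 2 ω) • piRes k m c α β γ 0 3 +
    (-1 * piRes k m c α β γ 1 3 ω) • piRes k m c α β γ 0 2 +
    (1 * piRes k m c α β γ 2 3 ω) • piRes k m c α β γ 0 1 : _ →ₗ[k] k) η
  simp [pprimeBil, piRes]
  ring

theorem range_pprimeBil_le {n : ℕ} (m c : ℕ) (α : Fin 4 → Fin n) (β : Fin m → Fin 2 → Fin n)
    (γ : Fin c → Fin n) :
    LinearMap.range (pprimeBil k m c α β γ) ≤
      Submodule.span k (Set.range (piFamily k m c α β γ)) := by
  rintro _ ⟨ω, rfl⟩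
  rw [pprimeBil_apply]
  exact Submodule.sum_mem _ fun s _ =>
    Submodule.smul_mem _ _ (Submodule.subset_span ⟨s.rev, rfl⟩)

theorem exists_dual_piFamily {n m c : ℕ} {α : Fin 4 → Fin n} {β : Fin m → Fin 2 → Fin n}
    {γ : Fin c → Fin n}
    (hE : Function.Injective (Sum.elim α (Sum.elim (fun x : Fin m × Fin 2 => β x.1 x.2) γ))) :
    ∃ w : Fin 6 → ⋀[k]^(2 + (m + c)) (Fin n → k),
      ∀ s t, piFamily k m c α β γ s (w t) = if s = t then 1 else 0 := by
  refine ⟨fun t => basisVec k _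
    (tupleP m c α β γ (![0, 0, 0, 1, 1, 2] t) (![1, 2, 3, 2, 3, 3] t) 0), fun s t => ?_⟩
  split_ifs with h
  · subst h
    exact piF_basisVec_self k hE (by revert s; decide)
  · exact piF_basisVec_eq_zero k hE (by revert s t; decide)

theorem linearIndependent_piFamily {n m c : ℕ} {α : Fin 4 → Fin n} {β : Fin m → Fin 2 → Fin n}
    {γ : Fin c → Fin n}
    (hE : Function.Injective (Sum.elim α (Sum.elim (fun x : Fin m × Fin 2 => β x.1 x.2) γ))) :
    LinearIndependent k (piFamily k m c α β γ) := by
  obtain ⟨w, hw⟩ := exists_dual_piFamily k hE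
  rw [Fintype.linearIndependent_iff]
  intro g hg t
  simpa [LinearMap.sum_apply, hw] using congrArg (fun f => f (w t)) hg

theorem range_pprimeBil_eq {n m c : ℕ} {α : Fin 4 → Fin n} {β : Fin m → Fin 2 → Fin n}
    {γ : Fin c → Fin n}
    (hE : Function.Injective (Sum.elim α (Sum.elim (fun x : Fin m × Fin 2 => β x.1 x.2) γ))) :
    LinearMap.range (pprimeBil k m c α β γ) =
      Submodule.span k (Set.range (piFamily k m c α β γ)) := by
  refine le_antisymm (range_pprimeBil_le k m c α β γ) (Submodule.span_le.mpr ?_)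
  obtain ⟨w, hw⟩ := exists_dual_piFamily k hE
  rintro _ ⟨t, rfl⟩
  refine ⟨(![1, -1, 1, 1, -1, 1] t.rev : k) • w t.rev, ?_⟩
  rw [map_smul, pprimeBil_apply]
  simp only [hw, mul_ite, mul_one, mul_zero, ite_smul, zero_smul, Finset.sum_ite_eq',
    Finset.mem_univ, if_true, Fin.rev_rev, smul_smul]
  have h : (![1, -1, 1, 1, -1, 1] t.rev : k) * ![1, -1, 1, 1, -1, 1] t.rev = 1 := by
    generalize t.rev = r
    fin_cases r <;> simp
  rw [h, one_smul]

/-- For `char k ≠ 2`, the quadratic form `P'_{A,B,C}` has rank at most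
`6`, and exactly `6` whenever all the indices `α_i`, `β_j^{(μ)}`, `γ_l` are distinct. -/
theorem pprime_rank
    {k : Type*} [Field k] (h2 : (2 : k) ≠ 0) {n : ℕ} (m c : ℕ)
    (α : Fin 4 → Fin n) (β : Fin m → Fin 2 → Fin n) (γ : Fin c → Fin n) :
    Module.finrank k ↥(LinearMap.range (pprimeBil k m c α β γ)) ≤ 6 ∧
      (Function.Injective
          (Sum.elim α (Sum.elim (fun x : Fin m × Fin 2 => β x.1 x.2) γ)) →
        Module.finrank k ↥(LinearMap.range (pprimeBil k m c α β γ)) = 6) := by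
  refine ⟨?_, fun hE => ?_⟩
  · exact (Submodule.finrank_mono (range_pprimeBil_le k m c α β γ)).trans
      (by simpa [Set.finrank] using finrank_range_le_card (R := k) (piFamily k m c α β γ))
  · rw [range_pprimeBil_eq k hE, finrank_span_eq_card (linearIndependent_piFamily k hE),
      Fintype.card_fin]

end
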